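/- Let T>0, let (x̄,ξ̄,r̄) ∈ 𝒟(𝒮) and set (x,ξ) := 𝒮(x̄,ξ̄,r̄). Then for every continuous function f:[0,T]×ℝ^d×ℝ^l→ℝ it holds that ∫_{[0,1]} f(r̄_u, x̄_u, ξ̄_u) dμ_{r̄}(u) = ∫₀^T f(t, x_t, ξ_t) dt, where μ_{r̄} is the Lebesgue–Stieltjes measure of r̄ on [0,1] and the right-hand side is the Lebesgue integral over [0,T]. -/

import Mathlib

open Set MeasureTheory

/-- Generalised inverse time change `r_t = inf{v ∈ [0,1] : r̄(v) > t}`, with `inf ∅ = 1`. -/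
noncomputable def invTime (rb : ℝ → ℝ) (t : ℝ) : ℝ :=
  sInf (insert 1 {v : ℝ | v ∈ Set.Icc (0:ℝ) 1 ∧ t < rb v})

theorem invTime_bddBelow (rb : ℝ → ℝ) (t : ℝ) :
    BddBelow (insert 1 {v : ℝ | v ∈ Set.Icc (0:ℝ) 1 ∧ t < rb v}) := by
  refine ⟨0, ?_⟩
  rintro v (rfl | hv)
  · exact zero_le_one
  · exact hv.1.1

theorem invTime_mem_Icc (rb : ℝ → ℝ) (t : ℝ) : invTime rb t ∈ Set.Icc (0:ℝ) 1 := by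
  refine ⟨le_csInf (Set.insert_nonempty _ _) ?_,
    csInf_le (invTime_bddBelow rb t) (Set.mem_insert _ _)⟩
  rintro v (rfl | hv)
  · exact zero_le_one
  · exact hv.1.1

theorem invTime_le {rb : ℝ → ℝ} {t v : ℝ} (hv : v ∈ Set.Icc (0:ℝ) 1) (h : t < rb v) :
    invTime rb t ≤ v :=
  csInf_le (invTime_bddBelow rb t) (Or.inr ⟨hv, h⟩)

theorem monotone_invTime (rb : ℝ → ℝ) : Monotone (invTime rb) := fun t s hts =>
  csInf_le_csInf (invTime_bddBelow rb t) (Set.insert_nonempty _ _)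
    (Set.insert_subset_insert fun _ hv => ⟨hv.1, hts.trans_lt hv.2⟩)

/-- For continuous monotone `rb`, `invTime rb` is a right inverse of `rb`. -/
theorem apply_invTime {rb : ℝ → ℝ} (hr : ContinuousOn rb (Set.Icc 0 1))
    (hmono : MonotoneOn rb (Set.Icc 0 1)) {t : ℝ} (ht : t ∈ Set.Icc (rb 0) (rb 1)) :
    rb (invTime rb t) = t := by
  have hmem := invTime_mem_Icc rb t
  apply le_antisymm
  · by_contra! h
    obtain ⟨v, hv, hvt⟩ := intermediate_value_Icc hmem.1
      (hr.mono (Set.Icc_subset_Icc_right hmem.2))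
      (show (t + rb (invTime rb t)) / 2 ∈ Set.Icc (rb 0) (rb (invTime rb t)) from
        ⟨by linarith [ht.1], by linarith⟩)
    have hle : invTime rb t ≤ v := invTime_le ⟨hv.1, hv.2.trans hmem.2⟩ (by linarith)
    rw [le_antisymm hv.2 hle] at hvt
    linarith
  · by_contra! h
    obtain ⟨v, hv, hvt⟩ := intermediate_value_Icc hmem.2
      (hr.mono (Set.Icc_subset_Icc_left hmem.1))
      (show (rb (invTime rb t) + t) / 2 ∈ Set.Icc (rb (invTime rb t)) (rb 1) from
        ⟨by linarith, by linarith [ht.2]⟩)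
    have hlt : invTime rb t < v := by
      refine lt_of_le_of_ne hv.1 fun heq => ?_
      rw [← heq] at hvt
      linarith
    obtain ⟨w, hw, hwv⟩ := exists_lt_of_csInf_lt (Set.insert_nonempty _ _) hlt
    rcases hw with rfl | ⟨hw, hwt⟩
    · exact absurd hv.2 (not_le.2 hwv)
    · have := hmono hw ⟨hmem.1.trans hv.1, hv.2⟩ hwv.le
      linarith

/-- The Lebesgue–Stieltjes measure of `rb` is the image of Lebesgue measure under `invTime rb`. -/
theorem eq_map_invTime {rb : ℝ → ℝ} (hr : ContinuousOn rb (Set.Icc 0 1))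
    (hmono : MonotoneOn rb (Set.Icc 0 1)) {μ : Measure ℝ}
    (hμ : ∀ a b : ℝ, 0 ≤ a → a ≤ b → b ≤ 1 → μ (Set.Icc a b) = ENNReal.ofReal (rb b - rb a))
    (hsupp : μ (Set.Icc (0:ℝ) 1)ᶜ = 0) :
    μ = (volume.restrict (Set.Icc (rb 0) (rb 1))).map (invTime rb) := by
  have hmeas : Measurable (invTime rb) := (monotone_invTime rb).measurable
  have hrestr : μ.restrict (Set.Icc 0 1) = μ :=
    Measure.restrict_eq_self_of_ae_mem (mem_ae_iff.2 hsupp)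
  have : IsFiniteMeasure μ := ⟨by
    rw [← hrestr, Measure.restrict_apply_univ, hμ 0 1 le_rfl zero_le_one le_rfl]
    exact ENNReal.ofReal_lt_top⟩
  refine Measure.ext_of_Iic _ _ fun a => ?_
  rw [Measure.map_apply hmeas measurableSet_Iic,
    Measure.restrict_apply (hmeas measurableSet_Iic), ← hrestr,
    Measure.restrict_apply measurableSet_Iic]
  rcases lt_or_ge a 0 with ha | ha
  · have h₁ : Set.Iic a ∩ Set.Icc (0:ℝ) 1 = ∅ := by
      ext v
      simp only [Set.mem_inter_iff, Set.mem_Iic, Set.mem_Icc, Set.mem_empty_iff_false, iff_false]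
      rintro ⟨h, h', -⟩
      linarith
    have h₂ : invTime rb ⁻¹' Set.Iic a = ∅ := by
      ext t
      simp only [Set.mem_preimage, Set.mem_Iic, Set.mem_empty_iff_false, iff_false, not_le]
      exact ha.trans_le (invTime_mem_Icc rb t).1
    simp [h₁, h₂]
  · have hb : min a 1 ∈ Set.Icc (0:ℝ) 1 := ⟨le_min ha zero_le_one, min_le_right _ _⟩
    have h₁ : Set.Iic a ∩ Set.Icc (0:ℝ) 1 = Set.Icc 0 (min a 1) := by
      ext v
      simp only [Set.mem_inter_iff, Set.mem_Iic, Set.mem_Icc, le_min_iff]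
      tauto
    rw [h₁, hμ 0 _ le_rfl hb.1 hb.2]
    apply le_antisymm
    · rw [← Real.volume_Ico]
      refine measure_mono fun t ht => ⟨?_, ht.1, ?_⟩
      · exact (invTime_le hb ht.2).trans (min_le_left _ _)
      · exact ht.2.le.trans (hmono hb (Set.right_mem_Icc.2 zero_le_one) hb.2)
    · rw [← Real.volume_Icc]
      refine measure_mono fun t ht => ⟨ht.2.1, ?_⟩
      rw [← apply_invTime hr hmono ht.2]
      exact hmono (invTime_mem_Icc rb t) hb (le_min ht.1 (invTime_mem_Icc rb t).2)

/-- time-change formula. For `(x̄,ξ̄,r̄) ∈ 𝒟(𝒮)` and `(x,ξ) = 𝒮(x̄,ξ̄,r̄)`,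
`∫_{[0,1]} f(r̄_u, x̄_u, ξ̄_u) dμ_{r̄}(u) = ∫_0^T f(t, x_t, ξ_t) dt`. -/
theorem stmt4 (T : ℝ) (hT : 0 < T) (d l : ℕ)
    (xb : ℝ → Fin d → ℝ) (ξb : ℝ → Fin l → ℝ) (rb : ℝ → ℝ)
    (hx : ContinuousOn xb (Set.Icc 0 1)) (hξ : ContinuousOn ξb (Set.Icc 0 1))
    (hr : ContinuousOn rb (Set.Icc 0 1))
    (hmemr : ∀ u ∈ Set.Icc (0:ℝ) 1, rb u ∈ Set.Icc 0 T)
    (hmonoξ : ∀ i, MonotoneOn (fun u => ξb u i) (Set.Icc 0 1))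
    (hmonor : MonotoneOn rb (Set.Icc 0 1))
    (hr0 : rb 0 = 0) (hr1 : rb 1 = T)
    (hmonox : ∀ a b : ℝ, 0 ≤ a → a ≤ b → b ≤ 1 → (∀ u ∈ Set.Icc a b, rb u = rb a) →
      ∀ i, MonotoneOn (fun u => xb u i) (Set.Icc a b) ∨ AntitoneOn (fun u => xb u i) (Set.Icc a b))
    (μ : Measure ℝ)
    (hμ : ∀ a b : ℝ, 0 ≤ a → a ≤ b → b ≤ 1 → μ (Set.Icc a b) = ENNReal.ofReal (rb b - rb a))
    (hsupp : μ (Set.Icc (0:ℝ) 1)ᶜ = 0)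
    (f : ℝ × (Fin d → ℝ) × (Fin l → ℝ) → ℝ)
    (hf : ContinuousOn f (Set.Icc 0 T ×ˢ (Set.univ : Set ((Fin d → ℝ) × (Fin l → ℝ))))) :
    ∫ u in Set.Icc (0:ℝ) 1, f (rb u, (xb u, ξb u)) ∂μ =
      ∫ t in Set.Icc (0:ℝ) T, f (t, (xb (invTime rb t), ξb (invTime rb t))) := by
  have hrestr : μ.restrict (Set.Icc 0 1) = μ :=
    Measure.restrict_eq_self_of_ae_mem (mem_ae_iff.2 hsupp)
  have hmap := eq_map_invTime hr hmonor hμ hsupp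
  rw [hr0, hr1] at hmap
  have hg : ContinuousOn (fun u => f (rb u, (xb u, ξb u))) (Set.Icc 0 1) :=
    hf.comp (hr.prodMk (hx.prodMk hξ)) fun u hu => ⟨hmemr u hu, Set.mem_univ _⟩
  have hgm := hg.aestronglyMeasurable (μ := μ) measurableSet_Icc
  rw [hrestr, hmap] at hgm
  rw [hrestr, hmap, integral_map (monotone_invTime rb).measurable.aemeasurable hgm]
  refine setIntegral_congr_fun measurableSet_Icc fun t ht => ?_
  simp only [apply_invTime hr hmonor (by rwa [hr0, hr1] : t ∈ Set.Icc (rb 0) (rb 1))]
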